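/- Let f be a sufficiently smooth orientation-preserving circle diffeomorphism with irrational rotation number α, convergents p_n/q_n, and β_n(x), M_n as above. For any r ∈ N* and any 1 ≤ l ≤ r there exists a constant C > 0 (depending only on f, r, l) such that for all n ≥ 0 and all x ∈ T: Σ_{i=0}^{q_{n+1}−1} (Df^i(x))^l ≤ C · M_n^{l−1} / β_n(x)^l. -/

import Mathlib

open Filter Topology

/-- `ρ` is the rotation (translation) number of the lift `F`. -/
def IsRotNumber (F : ℝ → ℝ) (ρ : ℝ) : Prop :=
  ∀ x : ℝ, Tendsto (fun n : ℕ => (F^[n] x - x) / (n : ℝ)) atTop (𝓝 ρ)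

/-- Iterates of the Gauss map `G(x) = {1/x}`, starting from the fractional part of `α`:
`α₀ = {α}`, `α_{n+1} = {1/α_n}`. -/
noncomputable def gaussIter (α : ℝ) : ℕ → ℝ
  | 0 => Int.fract α
  | n + 1 => Int.fract (gaussIter α n)⁻¹

/-- The `(n+1)`-st partial quotient `a_{n+1} = ⌊1/α_n⌋` of the continued fraction of `α`. -/
noncomputable def cfa (α : ℝ) (n : ℕ) : ℕ := ⌊(gaussIter α n)⁻¹⌋₊

/-- The denominators `q_n` of the convergents of `α`: `q₀ = 1`, `q₁ = a₁`,
`q_{n+2} = a_{n+2} q_{n+1} + q_n`. -/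
noncomputable def qden (α : ℝ) : ℕ → ℕ
  | 0 => 1
  | 1 => cfa α 0
  | n + 2 => cfa α (n + 1) * qden α (n + 1) + qden α n

/-- The Brjuno condition: `Σ_n log(q_{n+1})/q_n < ∞`. -/
def IsBrjuno (α : ℝ) : Prop :=
  Summable fun n : ℕ => Real.log (qden α (n + 1)) / (qden α n : ℝ)

/-- The numerators `p_n` of the convergents of `α`: `p₀ = 0`, `p₁ = 1`,
`p_{n+2} = a_{n+2} p_{n+1} + p_n`. -/
noncomputable def pnum (α : ℝ) : ℕ → ℕ
  | 0 => 0
  | 1 => 1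
  | n + 2 => cfa α (n + 1) * pnum α (n + 1) + pnum α n

/-- `β_n(x) = |f^{q_n}(x) - x|`: the length of the circle interval `I_n(x)` with endpoints
`x` and `f^{q_n}(x)`, computed on the lift `F` as `|F^[q_n](x) - x - p_n|`. -/
noncomputable def betaN (α : ℝ) (F : ℝ → ℝ) (n : ℕ) (x : ℝ) : ℝ :=
  |F^[qden α n] x - x - (pnum α n : ℝ)|

/-- `M_n = max_{x ∈ 𝕋} β_n(x)`. -/
noncomputable def Mseq (α : ℝ) (F : ℝ → ℝ) (n : ℕ) : ℝ :=
  sSup (Set.range (betaN α F n))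

/-- `m_n = min_{x ∈ 𝕋} β_n(x)`. -/
noncomputable def mseq (α : ℝ) (F : ℝ → ℝ) (n : ℕ) : ℝ :=
  sInf (Set.range (betaN α F n))

section ContinuedFraction

variable {α : ℝ}

lemma irrational_gaussIter (hirr : Irrational α) (n : ℕ) : Irrational (gaussIter α n) := by
  induction n with
  | zero => exact hirr.sub_intCast _
  | succ n ih => exact ih.inv.sub_intCast _

lemma gaussIter_pos (hirr : Irrational α) (n : ℕ) : 0 < gaussIter α n := by
  refine lt_of_le_of_ne ?_ (irrational_gaussIter hirr n).ne_zero.symm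
  cases n <;> exact Int.fract_nonneg _

lemma gaussIter_lt_one (n : ℕ) : gaussIter α n < 1 := by
  cases n <;> exact Int.fract_lt_one _

lemma inv_gaussIter (hirr : Irrational α) (n : ℕ) :
    (gaussIter α n)⁻¹ = cfa α n + gaussIter α (n + 1) := by
  rw [cfa, natCast_floor_eq_intCast_floor (inv_nonneg.2 (gaussIter_pos hirr n).le)]
  exact (Int.floor_add_fract _).symm

lemma one_le_cfa (hirr : Irrational α) (n : ℕ) : 1 ≤ cfa α n :=
  Nat.le_floor (by
    simpa using (one_le_inv₀ (gaussIter_pos hirr n)).2 (gaussIter_lt_one n).le)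

lemma qden_pos (hirr : Irrational α) (n : ℕ) : 0 < qden α n := by
  induction n using Nat.twoStepInduction with
  | zero => simp [qden]
  | one => exact one_le_cfa hirr 0
  | more n ih _ => exact Nat.lt_of_lt_of_le ih (Nat.le_add_left _ _)

/-- Consecutive convergents have determinant `±1`. -/
lemma convergent_det_sq (α : ℝ) (n : ℕ) :
    ((pnum α (n + 1) : ℤ) * qden α n - pnum α n * qden α (n + 1)) ^ 2 = 1 := by
  induction n with
  | zero => simp [pnum, qden]
  | succ n ih =>
    rw [← ih]
    simp only [pnum, qden]
    push_cast
    ring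

/-- The signed errors `q_n α - p_n` of the convergents satisfy `D_{n+1} = -α_{n+1} D_n`. -/
lemma convergent_error_succ (hirr : Irrational α) (hα : α ∈ Set.Ioo (0 : ℝ) 1) (n : ℕ) :
    qden α (n + 1) * α - pnum α (n + 1) =
      -gaussIter α (n + 1) * (qden α n * α - pnum α n) := by
  induction n with
  | zero =>
    have h := inv_gaussIter hirr 0
    have h0 : gaussIter α 0 = α := Int.fract_eq_self.2 ⟨hα.1.le, hα.2⟩
    rw [h0] at h
    have h1 : (cfa α 0 + gaussIter α 1) * α = 1 := by
      rw [← h, inv_mul_cancel₀ hα.1.ne']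
    simp only [qden, pnum, zero_add]
    push_cast
    linarith
  | succ n ih =>
    have h1 : gaussIter α (n + 1) * (cfa α (n + 1) + gaussIter α (n + 2)) = 1 := by
      rw [← inv_gaussIter hirr, mul_inv_cancel₀ (gaussIter_pos hirr _).ne']
    have h2 : (qden α (n + 2) * α - pnum α (n + 2) : ℝ) =
        cfa α (n + 1) * (qden α (n + 1) * α - pnum α (n + 1)) +
          (qden α n * α - pnum α n) := by
      simp only [qden, pnum]
      push_cast
      ring
    rw [h2, ih]
    linear_combination (-(qden α n * α - pnum α n)) * h1

lemma convergent_error_ne_zero (hirr : Irrational α) (n : ℕ) :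
    (qden α n * α - pnum α n : ℝ) ≠ 0 :=
  ((hirr.natCast_mul (qden_pos hirr n).ne').sub_natCast _).ne_zero

lemma convergent_error_mul_succ_neg (hirr : Irrational α) (hα : α ∈ Set.Ioo (0 : ℝ) 1)
    (n : ℕ) :
    (qden α n * α - pnum α n) * (qden α (n + 1) * α - pnum α (n + 1)) < 0 := by
  rw [convergent_error_succ hirr hα]
  have h1 := mul_self_pos.2 (convergent_error_ne_zero hirr n)
  nlinarith [mul_pos (gaussIter_pos hirr (n + 1)) h1]

/-- Convergents are best approximations: if `|m| < q_{n+1}` and `(m, k) ≠ (0, 0)`, then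
`|m α + k| ≥ |q_n α - p_n|`. -/
lemma abs_convergent_error_le (hirr : Irrational α) (hα : α ∈ Set.Ioo (0 : ℝ) 1) (n : ℕ)
    {m k : ℤ} (hm : |m| < qden α (n + 1)) (hmk : ¬(m = 0 ∧ k = 0)) :
    |(qden α n * α - pnum α n : ℝ)| ≤ |m * α + k| := by
  have hdet := convergent_det_sq α n
  have hneg := convergent_error_mul_succ_neg hirr hα n
  have hq : (0 : ℤ) < qden α n := by exact_mod_cast qden_pos hirr n
  have hq' : (0 : ℤ) < qden α (n + 1) := by exact_mod_cast qden_pos hirr (n + 1)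
  set q : ℤ := (qden α n : ℤ) with hqdef
  set q' : ℤ := (qden α (n + 1) : ℤ) with hq'def
  set p : ℤ := (pnum α n : ℤ) with hpdef
  set p' : ℤ := (pnum α (n + 1) : ℤ) with hp'def
  obtain ⟨u, v, hu, hv⟩ : ∃ u v : ℤ, m = u * q + v * q' ∧ -k = u * p + v * p' := by
    refine ⟨(p' * q - p * q') * (m * p' + k * q'),
      (p' * q - p * q') * (-k * q - m * p), ?_, ?_⟩
    · linear_combination (-m) * hdet
    · linear_combination k * hdet
  set D : ℝ := qden α n * α - pnum α n with hD
  set D' : ℝ := qden α (n + 1) * α - pnum α (n + 1) with hD'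
  have hsum : (m * α + k : ℝ) = u * D + v * D' := by
    have h1 : (m : ℝ) = u * qden α n + v * qden α (n + 1) := by
      rw [hu, hqdef, hq'def]; push_cast; ring
    have h2 : (-k : ℝ) = u * pnum α n + v * pnum α (n + 1) := by
      have : ((-k : ℤ) : ℝ) = ((u * p + v * p' : ℤ) : ℝ) := by rw [hv]
      rw [hpdef, hp'def] at this
      push_cast at this
      linarith
    rw [hD, hD']
    linear_combination α * h1 - h2
  have hm' := abs_lt.1 hm
  have hu0 : u ≠ 0 := by
    rintro rfl
    have hv0 : v = 0 := by
      rcases lt_trichotomy v 0 with h | h | h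
      · nlinarith
      · exact h
      · nlinarith
    subst hv0
    exact hmk ⟨by simpa using hu, by simpa using hv⟩
  have huv : u * v ≤ 0 := by
    by_contra! h
    rcases pos_and_pos_or_neg_and_neg_of_mul_pos h with ⟨h1, h2⟩ | ⟨h1, h2⟩ <;> nlinarith
  have hu1 : (1 : ℝ) ≤ (u : ℝ) ^ 2 := by
    have : 0 < u ^ 2 := by positivity
    exact_mod_cast Int.add_one_le_iff.2 this
  have huv' : (u * v : ℝ) ≤ 0 := by exact_mod_cast huv
  rw [hsum, ← sq_le_sq]
  nlinarith [mul_nonneg_of_nonpos_of_nonpos huv' hneg.le, sq_nonneg (v * D'),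
    mul_nonneg (sub_nonneg.2 hu1) (sq_nonneg D)]

end ContinuedFraction

/-- Finitely many intervals whose integer translates are pairwise disjoint have total length at
most `1`. -/
lemma sum_length_le_one_of_disjoint_mod_one (N : ℕ) (A B : ℕ → ℝ) (hAB : ∀ i, A i ≤ B i)
    (hdisj : ∀ i < N, ∀ j < N, ∀ k : ℤ, A i < B j + k → A j + k < B i → i = j ∧ k = 0) :
    ∑ i ∈ Finset.range N, (B i - A i) ≤ 1 := by
  set S : Set ℝ := ⋃ i ∈ Finset.range N, Set.Ioo (A i) (B i) with hS
  have hvol : MeasureTheory.volume S =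
      ENNReal.ofReal (∑ i ∈ Finset.range N, (B i - A i)) := by
    rw [hS, MeasureTheory.measure_biUnion_finset, ENNReal.ofReal_sum_of_nonneg]
    · simp
    · exact fun i _ => sub_nonneg.2 (hAB i)
    · intro i hi j hj hij
      refine Set.disjoint_left.2 fun y hy hy' => hij (hdisj i ?_ j ?_ 0 ?_ ?_).1
      · simpa using hi
      · simpa using hj
      · simpa using hy.1.trans hy'.2
      · simpa using hy'.1.trans hy.2
    · exact fun _ _ => measurableSet_Ioo
  by_contra! hlt
  obtain ⟨⟨_, s, rfl⟩, ⟨_, t, rfl⟩, hst, hnd⟩ :=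
    MeasureTheory.exists_pair_mem_lattice_not_disjoint_vadd
      (isAddFundamentalDomain_Ioc one_pos (0 : ℝ))
      (s := S) (Finset.measurableSet_biUnion _ fun _ _ => measurableSet_Ioo).nullMeasurableSet
      (by
        rw [hvol, Real.volume_Ioc]
        exact (ENNReal.ofReal_lt_ofReal_iff (by linarith)).2 (by linarith))
  obtain ⟨_, ⟨y, hy, rfl⟩, ⟨z, hz, hzy⟩⟩ := Set.not_disjoint_iff.1 hnd
  simp only [AddSubgroup.vadd_def, vadd_eq_add, zsmul_eq_mul, mul_one] at hzy
  simp only [hS, Set.mem_iUnion, Finset.mem_range, Set.mem_Ioo] at hy hz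
  obtain ⟨i, hi, hy1, hy2⟩ := hy
  obtain ⟨j, hj, hz1, hz2⟩ := hz
  have h := (hdisj i hi j hj (t - s) (by push_cast; linarith) (by push_cast; linarith)).2
  exact hst (by simp [sub_eq_zero.1 h])

namespace CircleDeg1Lift

/-- Orbit points are ordered like the orbit of the rotation by the translation number. -/
lemma le_of_iterate_add_int_le (f : CircleDeg1Lift) {m m' : ℕ} {k k' : ℤ} {x : ℝ}
    (h : (f ^ m) x + k ≤ (f ^ m') x + k') :
    m * translationNumber f + k ≤ m' * translationNumber f + k' := by
  rcases le_total m m' with hm | hm <;> obtain ⟨d, rfl⟩ := Nat.exists_eq_add_of_le' hm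
  · rw [pow_add, mul_apply] at h
    have h1 := (f ^ d).le_translationNumber_of_add_int_le (x := (f ^ m) x) (m := k - k')
      (by push_cast; linarith)
    rw [translationNumber_pow] at h1
    push_cast at h1 ⊢
    linarith
  · rw [pow_add, mul_apply] at h
    have h1 := (f ^ d).translationNumber_le_of_le_add_int (x := (f ^ m') x) (m := k' - k)
      (by push_cast; linarith)
    rw [translationNumber_pow] at h1
    push_cast at h1 ⊢
    linarith

lemma lt_of_iterate_add_int_lt (f : CircleDeg1Lift) (hf : Irrational (translationNumber f))
    {m m' : ℕ} {k k' : ℤ} {x : ℝ} (h : (f ^ m) x + k < (f ^ m') x + k') :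
    m * translationNumber f + k < m' * translationNumber f + k' := by
  refine lt_of_le_of_ne (f.le_of_iterate_add_int_le h.le) fun heq => h.ne ?_
  have hm : (m : ℤ) - m' = 0 := by
    by_contra hne
    refine ((hf.intCast_mul hne).add_intCast (k - k')).ne_zero ?_
    push_cast
    linarith
  obtain rfl : m = m' := by omega
  rw [add_left_cancel heq]

end CircleDeg1Lift

section Distortion

variable {F : ℝ → ℝ}

lemma deriv_iterate_eq_prod (hF : Differentiable ℝ F) (i : ℕ) (x : ℝ) :
    deriv (F^[i]) x = ∏ j ∈ Finset.range i, deriv F (F^[j] x) := by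
  induction i with
  | zero => simp
  | succ i ih =>
    rw [Function.iterate_succ', deriv_comp x (hF _) ((hF.iterate i) x), ih,
      Finset.prod_range_succ, mul_comm]

/-- The derivative of a `C²` degree one lift has Lipschitz logarithm. -/
lemma exists_lipschitz_log_deriv (hF : ContDiff ℝ 2 F) (hpos : ∀ x, 0 < deriv F x)
    (hper : ∀ x, F (x + 1) = F x + 1) :
    ∃ K : ℝ, 0 ≤ K ∧
      ∀ u v, Real.log (deriv F u) - Real.log (deriv F v) ≤ K * |u - v| := by
  have hF1 : ContDiff ℝ 1 (deriv F) := ((contDiff_succ_iff_deriv (n := 1)).1 hF).2.2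
  have hg : ContDiff ℝ 1 (fun x => Real.log (deriv F x)) := hF1.log fun x => (hpos x).ne'
  have hper1 : Function.Periodic (deriv F) 1 := fun x => by
    rw [← deriv_comp_add_const, funext hper, deriv_add_const]
  have hper2 : Function.Periodic (deriv fun x => Real.log (deriv F x)) 1 := fun x => by
    rw [← deriv_comp_add_const]
    simp only [hper1 _]
  obtain ⟨K, hK⟩ := (hper2.isBounded_of_continuous one_ne_zero
    (hg.continuous_deriv le_rfl)).exists_norm_le
  have hK' : ∀ x, ‖deriv (fun x => Real.log (deriv F x)) x‖ ≤ K := fun x => hK _ ⟨x, rfl⟩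
  refine ⟨K, (norm_nonneg _).trans (hK' 0), fun u v => (le_abs_self _).trans ?_⟩
  exact Convex.norm_image_sub_le_of_norm_deriv_le
    (fun x _ => (hg.differentiable one_ne_zero) x) (fun x _ => hK' x) convex_univ
    (Set.mem_univ v) (Set.mem_univ u)

/-- Denjoy-type distortion bound for an interval whose first iterates have bounded total
length. -/
lemma deriv_iterate_mul_length_le (hF : Differentiable ℝ F) (hpos : ∀ x, 0 < deriv F x)
    {K : ℝ} (hK0 : 0 ≤ K)
    (hK : ∀ u v, Real.log (deriv F u) - Real.log (deriv F v) ≤ K * |u - v|)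
    {a b x : ℝ} (hab : a < b) (hx : x ∈ Set.Icc a b) {i : ℕ}
    (hsum : ∑ j ∈ Finset.range i, (F^[j] b - F^[j] a) ≤ 1) :
    deriv (F^[i]) x * (b - a) ≤ Real.exp K * (F^[i] b - F^[i] a) := by
  have hmono : StrictMono F := strictMono_of_deriv_pos hpos
  obtain ⟨y, hy, hyi⟩ := exists_deriv_eq_slope (F^[i]) hab
    (hF.iterate i).continuous.continuousOn (hF.iterate i).differentiableOn
  have hba : 0 < b - a := sub_pos.2 hab
  rw [eq_div_iff hba.ne'] at hyi
  rw [← hyi, ← mul_assoc]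
  refine mul_le_mul_of_nonneg_right ?_ hba.le
  have hprod : ∀ z, 0 < deriv (F^[i]) z := fun z => by
    rw [deriv_iterate_eq_prod hF]
    exact Finset.prod_pos fun j _ => hpos _
  have hlog : ∀ z, Real.log (deriv (F^[i]) z) =
      ∑ j ∈ Finset.range i, Real.log (deriv F (F^[j] z)) := fun z => by
    rw [deriv_iterate_eq_prod hF, Real.log_prod fun j _ => (hpos _).ne']
  have hdiff : Real.log (deriv (F^[i]) x) - Real.log (deriv (F^[i]) y) ≤ K := by
    rw [hlog, hlog, ← Finset.sum_sub_distrib]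
    calc ∑ j ∈ Finset.range i, (Real.log (deriv F (F^[j] x)) - Real.log (deriv F (F^[j] y)))
        ≤ ∑ j ∈ Finset.range i, K * (F^[j] b - F^[j] a) := by
          refine Finset.sum_le_sum fun j _ => (hK _ _).trans ?_
          refine mul_le_mul_of_nonneg_left ?_ hK0
          have hj := (hmono.iterate j).monotone
          exact Set.abs_sub_le_of_uIcc_subset_uIcc (Set.uIcc_subset_uIcc
            (Set.mem_uIcc_of_le (hj hy.1.le) (hj hy.2.le))
            (Set.mem_uIcc_of_le (hj hx.1) (hj hx.2))) |>.trans
              (abs_of_nonneg (sub_nonneg.2 (hj hab.le))).le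
      _ ≤ K := by
          rw [← Finset.mul_sum]
          exact mul_le_of_le_one_right hK0 hsum
  rw [← Real.exp_log (hprod x), ← Real.exp_log (hprod y), ← Real.exp_add, Real.exp_le_exp]
  linarith

end Distortion

/-- The intervals `F^i(I_n(x))`, `0 ≤ i < q_{n+1}`, have total length at most `1`. -/
lemma exists_interval_iterates {α : ℝ} (hirr : Irrational α) (hα : α ∈ Set.Ioo (0 : ℝ) 1)
    (f : CircleDeg1Lift) (hf : f.translationNumber = α) (hmono : StrictMono f)
    (n : ℕ) (x : ℝ) :
    ∃ a b : ℝ, a < b ∧ x ∈ Set.Icc a b ∧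
      (∀ i, f^[i] b - f^[i] a = betaN α f n (f^[i] x)) ∧
      ∑ i ∈ Finset.range (qden α (n + 1)), (f^[i] b - f^[i] a) ≤ 1 := by
  have hφ : ∀ i, f^[i] ((f ^ qden α n) x - pnum α n) =
      (f ^ (i + qden α n)) x - pnum α n := fun i => by
    rw [← CircleDeg1Lift.coe_pow, CircleDeg1Lift.map_sub_nat, pow_add,
      CircleDeg1Lift.mul_apply]
  have hφ' : ∀ i, f^[qden α n] (f^[i] x) = (f ^ (i + qden α n)) x := fun i => by
    rw [← Function.iterate_add_apply, CircleDeg1Lift.coe_pow, add_comm]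
  have hbest : ∀ i < qden α (n + 1), ∀ j < qden α (n + 1), ∀ k : ℤ,
      |((j : ℝ) - i) * α + k| < |(qden α n * α - pnum α n : ℝ)| → i = j ∧ k = 0 := by
    intro i hi j hj k h
    by_contra hne
    refine absurd (abs_convergent_error_le hirr hα n (m := (j : ℤ) - i) (k := k) ?_ ?_) ?_
    · rw [abs_lt]; omega
    · omega
    · push_cast
      exact not_le.2 h
  have hlt : ∀ {m m' : ℕ} {k k' : ℤ}, (f ^ m) x + k < (f ^ m') x + k' →
      m * α + k < m' * α + k' := fun h => by
    simpa only [hf] using f.lt_of_iterate_add_int_lt (hf ▸ hirr) h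
  have hle : ∀ {m m' : ℕ} {k k' : ℤ}, (f ^ m) x + k ≤ (f ^ m') x + k' →
      m * α + k ≤ m' * α + k' := fun h => by
    simpa only [hf] using f.le_of_iterate_add_int_le h
  rcases (convergent_error_ne_zero hirr n).lt_or_gt with hD | hD
  · have hab : (f ^ qden α n) x - pnum α n < x := by
      by_contra! h
      have := @hle 0 (qden α n) 0 (-pnum α n) (by push_cast; simpa [← sub_eq_add_neg] using h)
      push_cast at this
      linarith
    refine ⟨_, _, hab, ⟨hab.le, le_rfl⟩, fun i => ?_, ?_⟩
    · have h := (hmono.iterate i).monotone hab.le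
      rw [hφ] at h
      rw [betaN, hφ, hφ', abs_of_nonpos] <;> linarith
    · refine sum_length_le_one_of_disjoint_mod_one _ _ _
        (fun i => (hmono.iterate i).monotone hab.le) fun i hi j hj k h1 h2 => ?_
      rw [hφ, ← CircleDeg1Lift.coe_pow] at h1 h2
      have h1' := @hlt (i + qden α n) j (-pnum α n) k (by push_cast; linarith)
      have h2' := @hlt (j + qden α n) i (k - pnum α n) 0 (by push_cast; linarith)
      refine hbest i hi j hj k ?_
      push_cast at h1' h2'
      rw [abs_of_neg hD, abs_lt]
      constructor <;> linarith
  · have hab : x < (f ^ qden α n) x - pnum α n := by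
      by_contra! h
      have := @hle (qden α n) 0 (-pnum α n) 0 (by push_cast; simpa [← sub_eq_add_neg] using h)
      push_cast at this
      linarith
    refine ⟨_, _, hab, ⟨le_rfl, hab.le⟩, fun i => ?_, ?_⟩
    · have h := (hmono.iterate i).monotone hab.le
      rw [hφ] at h
      rw [betaN, hφ, hφ', abs_of_nonneg] <;> linarith
    · refine sum_length_le_one_of_disjoint_mod_one _ _ _
        (fun i => (hmono.iterate i).monotone hab.le) fun i hi j hj k h1 h2 => ?_
      rw [hφ, ← CircleDeg1Lift.coe_pow] at h1 h2
      have h1' := @hlt i (j + qden α n) 0 (k - pnum α n) (by push_cast; linarith)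
      have h2' := @hlt j (i + qden α n) k (-pnum α n) (by push_cast; linarith)
      refine hbest i hi j hj k ?_
      push_cast at h1' h2'
      rw [abs_of_pos hD, abs_lt]
      constructor <;> linarith

/-- **Distortion lemma.** Let `f` be a smooth orientation-preserving circle diffeomorphism
with irrational rotation number `α ∈ (0,1)`. For any `r ∈ ℕ*` and any `1 ≤ l ≤ r` there
is a constant `C > 0` (depending only on `f`, `r`, `l`) such that for all `n` and `x`:
`Σ_{i=0}^{q_{n+1}-1} (Df^i(x))^l ≤ C M_n^{l-1} / β_n(x)^l`. -/
theorem sum_deriv_iterates_bound (α : ℝ) (hirr : Irrational α)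
    (hα : α ∈ Set.Ioo (0 : ℝ) 1)
    (F : ℝ → ℝ) (hF : ContDiff ℝ (⊤ : ℕ∞) F) (hFderiv : ∀ x, 0 < deriv F x)
    (hFper : ∀ x, F (x + 1) = F x + 1) (hρ : IsRotNumber F α)
    (r : ℕ) (hr : 1 ≤ r) (l : ℕ) (hl1 : 1 ≤ l) (hlr : l ≤ r) :
    ∃ C > (0 : ℝ), ∀ (n : ℕ) (x : ℝ),
      ∑ i ∈ Finset.range (qden α (n + 1)), (deriv (F^[i]) x) ^ l ≤
        C * Mseq α F n ^ (l - 1) / betaN α F n x ^ l := by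
  have hmono : StrictMono F := strictMono_of_deriv_pos hFderiv
  have hdiff : Differentiable ℝ F := hF.differentiable (by simp)
  let f : CircleDeg1Lift := ⟨⟨F, hmono.monotone⟩, hFper⟩
  have hf : f.translationNumber = α := by
    refine tendsto_nhds_unique (f.tendsto_translationNumber 0) ?_
    simp only [CircleDeg1Lift.coe_pow]
    exact hρ 0
  obtain ⟨K, hK0, hK⟩ := exists_lipschitz_log_deriv (contDiff_infty.1 hF 2)
    hFderiv hFper
  have hint := exists_interval_iterates hirr hα f hf hmono
  have hβ : ∀ n x, betaN α F n x ≤ Mseq α F n := fun n x => by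
    refine le_csSup ⟨1, ?_⟩ ⟨x, rfl⟩
    rintro _ ⟨y, rfl⟩
    obtain ⟨a, b, hab, -, hlen, hsum⟩ := hint n y
    have h := Finset.single_le_sum (f := fun i => f^[i] b - f^[i] a)
      (fun i _ => sub_nonneg.2 ((hmono.iterate i).monotone hab.le))
      (Finset.mem_range.2 (qden_pos hirr (n + 1)))
    exact (hlen 0).symm.le.trans (h.trans hsum)
  refine ⟨Real.exp K ^ l, pow_pos (Real.exp_pos K) l, fun n x => ?_⟩
  obtain ⟨a, b, hab, hx, hlen, hsum⟩ := hint n x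
  have hlen0 : b - a = betaN α F n x := hlen 0
  have hnonneg : ∀ i, 0 ≤ F^[i] b - F^[i] a := fun i =>
    sub_nonneg.2 ((hmono.iterate i).monotone hab.le)
  have hba : 0 < b - a := sub_pos.2 hab
  rw [← hlen0, le_div_iff₀ (pow_pos hba l), Finset.sum_mul]
  have hM : 0 ≤ Mseq α F n := (abs_nonneg _).trans (hβ n x)
  have hterm : ∀ i ∈ Finset.range (qden α (n + 1)), deriv (F^[i]) x ^ l * (b - a) ^ l ≤
      Real.exp K ^ l * Mseq α F n ^ (l - 1) * (F^[i] b - F^[i] a) := fun i hi => by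
    have hsum_i : ∑ j ∈ Finset.range i, (F^[j] b - F^[j] a) ≤ 1 :=
      (Finset.sum_le_sum_of_subset_of_nonneg
        (Finset.range_subset_range.2 (Finset.mem_range.1 hi).le)
        fun j _ _ => hnonneg j).trans hsum
    have hderiv_nonneg : 0 ≤ deriv (F^[i]) x := by
      rw [deriv_iterate_eq_prod hdiff]
      exact Finset.prod_nonneg fun j _ => (hFderiv _).le
    have hlen_le : F^[i] b - F^[i] a ≤ Mseq α F n := (hlen i).le.trans (hβ n _)
    calc deriv (F^[i]) x ^ l * (b - a) ^ l = (deriv (F^[i]) x * (b - a)) ^ l :=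
          (mul_pow _ _ _).symm
      _ ≤ (Real.exp K * (F^[i] b - F^[i] a)) ^ l :=
          pow_le_pow_left₀ (mul_nonneg hderiv_nonneg hba.le)
            (deriv_iterate_mul_length_le hdiff hFderiv hK0 hK hab hx hsum_i) l
      _ = Real.exp K ^ l * (F^[i] b - F^[i] a) ^ (l - 1) * (F^[i] b - F^[i] a) := by
          rw [mul_pow, mul_assoc, ← pow_succ, Nat.sub_add_cancel hl1]
      _ ≤ Real.exp K ^ l * Mseq α F n ^ (l - 1) * (F^[i] b - F^[i] a) := by
          have := hnonneg i
          gcongr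
  refine (Finset.sum_le_sum hterm).trans ?_
  rw [← Finset.mul_sum]
  exact mul_le_of_le_one_right (by positivity) hsum
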